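/- For every nonzero f ∈ S_B there exist q₁, q₂, q₃ ∈ Q_B with f = q₁q₂q₃. That is, every nonzero homogeneous polynomial of degree 6 in ℂ[x₁,x₂,x₃] whose Hessian matrix vanishes at the four points (0,0,1), (0,1,0), (1,0,0), (1,1,1) is a product of three quadratic polynomials vanishing at those four points. -/

import Mathlib

open MvPolynomial

noncomputable section

/-- The Hessian matrix of `f` (the matrix of second partial derivatives) vanishes at `p`. -/
def HessVanishesAt (f : MvPolynomial (Fin 3) ℂ) (p : Fin 3 → ℂ) : Prop :=
  ∀ i j : Fin 3, eval p (pderiv i (pderiv j f)) = 0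

/-- The four points `[0:0:1]`, `[0:1:0]`, `[1:0:0]`, `[1:1:1]` of `ℙ²` in general position. -/
def Bpts : Set (Fin 3 → ℂ) := {![0,0,1], ![0,1,0], ![1,0,0], ![1,1,1]}

/-- `Q_B`: the set of quadratic polynomials `a₁ x₂x₃ + a₂ x₁x₃ + a₃ x₁x₂` with
`a₁ + a₂ + a₃ = 0`, i.e. the quadrics through the four points of `Bpts`. -/
def QB : Set (MvPolynomial (Fin 3) ℂ) :=
  {q | ∃ a₁ a₂ a₃ : ℂ, a₁ + a₂ + a₃ = 0 ∧
    q = C a₁ * (X 1 * X 2) + C a₂ * (X 0 * X 2) + C a₃ * (X 0 * X 1)}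

/-- A ternary form of degree `n` is a combination of the monomials `x₀ⁱ x₁ʲ x₂ⁿ⁻ⁱ⁻ʲ`. -/
theorem exists_eq_sum_of_isHomogeneous {R : Type*} [CommSemiring R] {n : ℕ}
    {f : MvPolynomial (Fin 3) R} (hf : f.IsHomogeneous n) :
    ∃ c : ℕ → ℕ → R, f = ∑ i ∈ Finset.range (n + 1), ∑ j ∈ Finset.range (n + 1 - i),
      C (c i j) * (X 0 ^ i * X 1 ^ j * X 2 ^ (n - i - j)) := by
  classical
  let e : (Σ _ : ℕ, ℕ) → (Fin 3 →₀ ℕ) := fun k =>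
    Finsupp.single 0 k.1 + Finsupp.single 1 k.2 + Finsupp.single 2 (n - k.1 - k.2)
  have he0 (k) : e k 0 = k.1 := by simp [e]
  have he1 (k) : e k 1 = k.2 := by simp [e]
  have he2 (k) : e k 2 = n - k.1 - k.2 := by simp [e]
  have hinj : Function.Injective e := by
    rintro ⟨a, b⟩ ⟨a', b'⟩ h
    have h0 := he0 ⟨a, b⟩
    have h1 := he1 ⟨a, b⟩
    rw [h, he0] at h0
    rw [h, he1] at h1
    simp_all
  refine ⟨fun i j => coeff (e ⟨i, j⟩) f, ?_⟩
  have hsub : f.support ⊆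
      ((Finset.range (n + 1)).sigma fun i => Finset.range (n + 1 - i)).image e := by
    intro d hd
    have hdeg := hf.degree_eq_sum_deg_support hd
    have hdeg' : d 0 + d 1 + d 2 = n := by
      rw [hdeg, ← Finsupp.degree_apply, Finsupp.degree_eq_sum, Fin.sum_univ_three]
    refine Finset.mem_image.2 ⟨⟨d 0, d 1⟩, ?_, ?_⟩
    · simp only [Finset.mem_sigma, Finset.mem_range]
      omega
    · ext t
      fin_cases t
      · exact he0 _
      · exact he1 _
      · refine (he2 _).trans ?_
        change n - d 0 - d 1 = d 2
        omega
  conv_lhs => rw [f.as_sum]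
  rw [Finset.sum_subset hsub fun d _ hd => by rw [notMem_support_iff.1 hd, map_zero],
    Finset.sum_image hinj.injOn, Finset.sum_sigma]
  refine Finset.sum_congr rfl fun i _ => Finset.sum_congr rfl fun j _ => ?_
  simp only [e, X_pow_eq_monomial, monomial_mul, C_mul_monomial, mul_one]

/-- A binary quadratic form over an algebraically closed field is a product of linear forms. -/
theorem exists_binary_quadratic_factorization {K : Type*} [Field K] [IsAlgClosed K] (a b c : K) :
    ∃ r₁ s₁ r₂ s₂ : K, a = r₁ * r₂ ∧ b = r₁ * s₂ + s₁ * r₂ ∧ c = s₁ * s₂ := by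
  by_cases ha : a = 0
  · exact ⟨0, 1, b, c, by simp [ha], by simp, by simp⟩
  · obtain ⟨z, hz⟩ := IsAlgClosed.exists_root
      (Polynomial.C a * Polynomial.X ^ 2 + Polynomial.C b * Polynomial.X + Polynomial.C c)
      (by rw [Polynomial.degree_quadratic ha]; decide)
    simp only [Polynomial.IsRoot.def, Polynomial.eval_add, Polynomial.eval_mul, Polynomial.eval_C,
      Polynomial.eval_pow, Polynomial.eval_X] at hz
    exact ⟨1, -z, a, b + a * z, by ring, by ring, by linear_combination hz⟩

/-- A binary cubic form over an algebraically closed field is a product of linear forms. -/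
theorem exists_binary_cubic_factorization {K : Type*} [Field K] [IsAlgClosed K] (a b c d : K) :
    ∃ r₁ s₁ r₂ s₂ r₃ s₃ : K, a = r₁ * r₂ * r₃ ∧
      b = r₁ * r₂ * s₃ + r₁ * s₂ * r₃ + s₁ * r₂ * r₃ ∧
      c = r₁ * s₂ * s₃ + s₁ * r₂ * s₃ + s₁ * s₂ * r₃ ∧ d = s₁ * s₂ * s₃ := by
  by_cases ha : a = 0
  · obtain ⟨r₁, s₁, r₂, s₂, h₁, h₂, h₃⟩ := exists_binary_quadratic_factorization b c d
    exact ⟨r₁, s₁, r₂, s₂, 0, 1, by simp [ha], by simp [h₁], by simp [h₂], by simp [h₃]⟩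
  · obtain ⟨z, hz⟩ := IsAlgClosed.exists_root
      (Polynomial.C a * Polynomial.X ^ 3 + Polynomial.C b * Polynomial.X ^ 2 +
        Polynomial.C c * Polynomial.X + Polynomial.C d)
      (by rw [Polynomial.degree_cubic ha]; decide)
    simp only [Polynomial.IsRoot.def, Polynomial.eval_add, Polynomial.eval_mul, Polynomial.eval_C,
      Polynomial.eval_pow, Polynomial.eval_X] at hz
    obtain ⟨r₁, s₁, r₂, s₂, h₁, h₂, h₃⟩ :=
      exists_binary_quadratic_factorization a (b + a * z) (c + b * z + a * z ^ 2)
    refine ⟨r₁, s₁, r₂, s₂, 1, -z, ?_, ?_, ?_, ?_⟩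
    · linear_combination h₁
    · linear_combination h₂ - z * h₁
    · linear_combination h₃ - z * h₂
    · linear_combination hz - z * h₃

/-- The first partial derivative of a ternary monomial. -/
theorem pderiv_zero_C_mul_monomial {R : Type*} [CommRing R] (r : R) (a b d : ℕ) :
    pderiv 0 (C r * (X (0 : Fin 3) ^ a * X 1 ^ b * X 2 ^ d)) =
      C (r * a) * (X 0 ^ (a - 1) * X 1 ^ b * X 2 ^ d) := by
  simp [pderiv_X]
  ring

/-- The second partial derivative of a ternary monomial. -/
theorem pderiv_one_C_mul_monomial {R : Type*} [CommRing R] (r : R) (a b d : ℕ) :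
    pderiv 1 (C r * (X (0 : Fin 3) ^ a * X 1 ^ b * X 2 ^ d)) =
      C (r * b) * (X 0 ^ a * X 1 ^ (b - 1) * X 2 ^ d) := by
  simp [pderiv_X]
  ring

/-- The third partial derivative of a ternary monomial. -/
theorem pderiv_two_C_mul_monomial {R : Type*} [CommRing R] (r : R) (a b d : ℕ) :
    pderiv 2 (C r * (X (0 : Fin 3) ^ a * X 1 ^ b * X 2 ^ d)) =
      C (r * d) * (X 0 ^ a * X 1 ^ b * X 2 ^ (d - 1)) := by
  simp [pderiv_X]
  ring

set_option maxHeartbeats 2000000 in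
/-- Every nonzero homogeneous polynomial `f` of degree 6 in `ℂ[x₁,x₂,x₃]` whose Hessian
matrix vanishes at the four points `(0,0,1)`, `(0,1,0)`, `(1,0,0)`, `(1,1,1)` (i.e. every
nonzero `f ∈ S_B`) is a product `q₁q₂q₃` of three elements of `Q_B`. -/
theorem SB_elements_factor (f : MvPolynomial (Fin 3) ℂ) (hf : f.IsHomogeneous 6)
    (hhess : ∀ p ∈ Bpts, HessVanishesAt f p) (hne : f ≠ 0) :
    ∃ q₁ q₂ q₃ : MvPolynomial (Fin 3) ℂ,
      q₁ ∈ QB ∧ q₂ ∈ QB ∧ q₃ ∈ QB ∧ f = q₁ * q₂ * q₃ := by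
  obtain ⟨c, hc⟩ := exists_eq_sum_of_isHomogeneous hf
  have h000 := hhess ![1, 0, 0] (by simp [Bpts]) 0 0
  have h011 := hhess ![1, 0, 0] (by simp [Bpts]) 1 1
  have h022 := hhess ![1, 0, 0] (by simp [Bpts]) 2 2
  have h001 := hhess ![1, 0, 0] (by simp [Bpts]) 0 1
  have h002 := hhess ![1, 0, 0] (by simp [Bpts]) 0 2
  have h012 := hhess ![1, 0, 0] (by simp [Bpts]) 1 2
  have h100 := hhess ![0, 1, 0] (by simp [Bpts]) 0 0
  have h111 := hhess ![0, 1, 0] (by simp [Bpts]) 1 1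
  have h122 := hhess ![0, 1, 0] (by simp [Bpts]) 2 2
  have h101 := hhess ![0, 1, 0] (by simp [Bpts]) 0 1
  have h102 := hhess ![0, 1, 0] (by simp [Bpts]) 0 2
  have h112 := hhess ![0, 1, 0] (by simp [Bpts]) 1 2
  have h200 := hhess ![0, 0, 1] (by simp [Bpts]) 0 0
  have h211 := hhess ![0, 0, 1] (by simp [Bpts]) 1 1
  have h222 := hhess ![0, 0, 1] (by simp [Bpts]) 2 2
  have h201 := hhess ![0, 0, 1] (by simp [Bpts]) 0 1
  have h202 := hhess ![0, 0, 1] (by simp [Bpts]) 0 2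
  have h212 := hhess ![0, 0, 1] (by simp [Bpts]) 1 2
  have h300 := hhess ![1, 1, 1] (by simp [Bpts]) 0 0
  have h311 := hhess ![1, 1, 1] (by simp [Bpts]) 1 1
  have h322 := hhess ![1, 1, 1] (by simp [Bpts]) 2 2
  have h301 := hhess ![1, 1, 1] (by simp [Bpts]) 0 1
  have h302 := hhess ![1, 1, 1] (by simp [Bpts]) 0 2
  have h312 := hhess ![1, 1, 1] (by simp [Bpts]) 1 2
  simp only [hc, map_sum, pderiv_zero_C_mul_monomial, pderiv_one_C_mul_monomial,
    pderiv_two_C_mul_monomial] at h000 h011 h022 h001 h002 h012 h100 h111 h122 h101 h102 h112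
  simp [Finset.sum_range_succ] at h000 h011 h022 h001 h002 h012 h100 h111 h122 h101 h102 h112
  simp only [hc, map_sum, pderiv_zero_C_mul_monomial, pderiv_one_C_mul_monomial,
    pderiv_two_C_mul_monomial] at h200 h211 h222 h201 h202 h212 h300 h311 h322 h301 h302 h312
  simp [Finset.sum_range_succ] at h200 h211 h222 h201 h202 h212 h300 h311 h322 h301 h302 h312
  have e13 : c 1 3 = -3 * c 0 3 - c 1 2 := by
    linear_combination -6 * h000 - h011 - h022 - 3 * h001 - 3 * h002 - h012 - 3 * h111 - 3
      * h122 - h101 - h102 - 3 * h112 - 3 * h211 - 3 * h222 - h201 - h202 - 3 * h212 + 1/5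
      * h300 + 1/10 * h311 + 1/10 * h322 - 1/5 * h301 - 1/5 * h302 + 1/5 * h312
  have e22 : c 2 2 = -2 * c 1 2 - 2 * c 2 1 := by
    linear_combination 9 * h000 + h011 + 3 * h022 + 4 * h001 + 6 * h002 + 2 * h012 + h100
      + 9 * h111 + 3 * h122 + 4 * h101 + 2 * h102 + 6 * h112 - 3 * h200 - 3 * h211 - 9 *
      h222 - 4 * h201 - 6 * h202 - 6 * h212 - 3/10 * h300 - 3/10 * h311 + 3/10 * h322 +
      2/5 * h301
  have e31 : c 3 1 = -c 2 1 - 3 * c 3 0 := by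
    linear_combination -3 * h000 - 3 * h022 - h001 - 3 * h002 - h012 - h100 - 6 * h111 -
      h122 - 3 * h101 - h102 - 3 * h112 - 3 * h200 - 3 * h222 - h201 - 3 * h202 - h212 +
      1/10 * h300 + 1/5 * h311 + 1/10 * h322 - 1/5 * h301 + 1/5 * h302 - 1/5 * h312
  have e23 : c 2 3 = 3 * c 0 3 + 2 * c 1 2 + c 2 1 := by
    linear_combination 6 * h000 + 2 * h011 + 4 * h001 + 2 * h002 + h012 - 2 * h100 - 6 *
      h111 - 4 * h101 - 2 * h102 - 3 * h112 + 2 * h200 + 6 * h211 + 12 * h222 + 4 * h201 +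
      6 * h202 + 9 * h212 - 1/5 * h300 + 1/5 * h311 - 2/5 * h322 + 2/5 * h302 - 1/5 * h312
  have e32 : c 3 2 = c 1 2 + 2 * c 2 1 + 3 * c 3 0 := by
    linear_combination -6 * h000 - 2 * h011 - 4 * h001 - 3 * h002 - 2 * h012 + 2 * h100 +
      6 * h111 + 4 * h101 + h102 + 2 * h112 + 6 * h200 + 2 * h211 + 12 * h222 + 4 * h201 +
      9 * h202 + 6 * h212 + 1/5 * h300 - 1/5 * h311 - 2/5 * h322 - 1/5 * h302 + 2/5 * h312
  have e33 : c 3 3 = -c 0 3 - c 1 2 - c 2 1 - c 3 0 := by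
    linear_combination -h000 - h011 - h001 - h100 - h111 - h101 - 3 * h200 - 3 * h211 - 10
      * h222 - 3 * h201 - 6 * h202 - 6 * h212 + 1/30 * h300 + 1/30 * h311 + 1/3 * h322 +
      1/15 * h301 - 2/15 * h302 - 2/15 * h312
  obtain ⟨r₁, s₁, r₂, s₂, r₃, s₃, hA, hB, hC, hD⟩ :=
    exists_binary_cubic_factorization (c 0 3) (c 1 2) (c 2 1) (c 3 0)
  refine ⟨_, _, _, ⟨r₁, s₁, -(r₁ + s₁), by ring, rfl⟩, ⟨r₂, s₂, -(r₂ + s₂), by ring, rfl⟩,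
    ⟨r₃, s₃, -(r₃ + s₃), by ring, rfl⟩, ?_⟩
  simp only [hc, Finset.sum_range_succ, Finset.sum_range_zero, Nat.reduceAdd, Nat.reduceSub,
    h000, h011, h022, h001, h002, h012, h100, h111, h122, h101, h102, h112,
    h200, h211, h222, h201, h202, h212,
    e13, e22, e31, e23, e32, e33, hA, hB, hC, hD, map_zero, map_add, map_sub, map_mul, map_neg,
    map_ofNat]
  ring
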